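/- arXiv:1805.06685 — 2 statements merged into one kernel-verified Lean document; each statement's English description precedes it below -/
import Mathlib

section
/- Let 𝓜 be a finite nonempty set of n×n binary NZ matrices and t ≥ 0. If K_𝓜(t) > 1/n then K_𝓜(t) ≥ (n+1)/n². -/
open scoped BigOperators

/-- Binary (Boolean) `n × n` matrices. -/
abbrev BMat (n : ℕ) := Matrix (Fin n) (Fin n) Bool

/-- Boolean matrix product: `(A ⊙ B)[i,j] = 1` iff `∑ₖ A[i,k]·B[k,j] > 0`. -/
def bProd {n : ℕ} (A B : BMat n) : BMat n :=
  Matrix.of fun i j => decide (∃ k, A i k = true ∧ B k j = true)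

/-- The identity binary matrix. -/
def bId (n : ℕ) : BMat n := Matrix.of fun i j => decide (i = j)

/-- The all-ones binary matrix. -/
def bOnes (n : ℕ) : BMat n := Matrix.of fun _ _ => true

/-- Boolean product of a list of binary matrices (empty product = identity). -/
def listProd {n : ℕ} (l : List (BMat n)) : BMat n := l.foldr bProd (bId n)

/-- A binary matrix is NZ if every row and every column contains a `1`. -/
def IsNZ {n : ℕ} (A : BMat n) : Prop :=
  (∀ i, ∃ j, A i j = true) ∧ (∀ j, ∃ i, A i j = true)

/-- `𝓜^{≤t}`: all boolean products of at most `t` matrices from `M`. -/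
def prodsLe {n : ℕ} (M : Set (BMat n)) (t : ℕ) : Set (BMat n) :=
  { P | ∃ l : List (BMat n), l.length ≤ t ∧ (∀ A ∈ l, A ∈ M) ∧ P = listProd l }

/-- `𝓜^{t}`: all boolean products of exactly `t` matrices from `M`. -/
def prodsEq {n : ℕ} (M : Set (BMat n)) (t : ℕ) : Set (BMat n) :=
  { P | ∃ l : List (BMat n), l.length = t ∧ (∀ A ∈ l, A ∈ M) ∧ P = listProd l }

/-- `(Ae)_i`: the number of `1`-entries in row `i` of `A`, as a real number. -/
def rowSum {n : ℕ} (A : BMat n) (i : Fin n) : ℝ :=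
  ∑ j, if A i j then (1 : ℝ) else 0

/-- The number of `1`-entries in row `i` of `A`, as a natural number. -/
def rCount {n : ℕ} (A : BMat n) (i : Fin n) : ℕ :=
  (Finset.univ.filter fun j => A i j = true).card

/-- A stochastic vector: nonnegative entries summing to `1`. -/
def IsStochastic {m : ℕ} (p : Fin m → ℝ) : Prop :=
  (∀ i, 0 ≤ p i) ∧ ∑ i, p i = 1

/-- `pᵀ(Ae)`. -/
def payoff {n : ℕ} (p : Fin n → ℝ) (A : BMat n) : ℝ := ∑ i, p i * rowSum A i

/-- `max_{A ∈ 𝓜^{≤t}} pᵀ(Ae)`. -/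
noncomputable def maxPayoff {n : ℕ} (M : Set (BMat n)) (t : ℕ) (p : Fin n → ℝ) : ℝ :=
  sSup { x | ∃ A ∈ prodsLe M t, x = payoff p A }

/-- The synchronizing probability function
`K_𝓜(t) = min_p max_{A ∈ 𝓜^{≤t}} pᵀ(Ae)/n`. -/
noncomputable def Kval {n : ℕ} (M : Set (BMat n)) (t : ℕ) : ℝ :=
  sInf { v | ∃ p : Fin n → ℝ, IsStochastic p ∧ v = maxPayoff M t p } / n

/-- The set `P_t` of optimal stochastic vectors for `K_𝓜(t)`. -/
noncomputable def Pset {n : ℕ} (M : Set (BMat n)) (t : ℕ) : Set (Fin n → ℝ) :=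
  { p | IsStochastic p ∧ maxPayoff M t p = n * Kval M t }

/-- A set of binary matrices is primitive if some (nonempty) boolean product of its
elements equals the all-ones matrix. -/
def IsPrimitive {n : ℕ} (M : Set (BMat n)) : Prop :=
  ∃ l : List (BMat n), l ≠ [] ∧ (∀ A ∈ l, A ∈ M) ∧ listProd l = bOnes n

/-- The exponent of a primitive set: the length of its shortest positive product. -/
noncomputable def expM {n : ℕ} (M : Set (BMat n)) : ℕ :=
  sInf { t | ∃ l : List (BMat n),
    l.length = t ∧ l ≠ [] ∧ (∀ A ∈ l, A ∈ M) ∧ listProd l = bOnes n }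

/-- `max_{A ∈ 𝓜^{≤t}} r_i(A)`. -/
noncomputable def rowMaxN {n : ℕ} (M : Set (BMat n)) (t : ℕ) (i : Fin n) : ℕ :=
  sSup { r | ∃ A ∈ prodsLe M t, r = rCount A i }

/-- `min_{1≤i≤n} max_{A ∈ 𝓜^{≤t}} r_i(A)`. -/
noncomputable def KbarN {n : ℕ} (M : Set (BMat n)) (t : ℕ) : ℕ :=
  sInf { r | ∃ i : Fin n, r = rowMaxN M t i }

/-- The approximated synchronizing probability function
`K̄_𝓜(t) = (1/n)·min_i max_{A ∈ 𝓜^{≤t}} r_i(A)`. -/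
noncomputable def Kbar {n : ℕ} (M : Set (BMat n)) (t : ℕ) : ℝ := (KbarN M t : ℝ) / n

/-- `P̄_t`: the set of row indices attaining the minimum in `K̄_𝓜(t)`. -/
noncomputable def Pbar {n : ℕ} (M : Set (BMat n)) (t : ℕ) : Set (Fin n) :=
  { i | rowMaxN M t i = KbarN M t }

lemma exists_listProd_eq_true {n : ℕ} (l : List (BMat n)) (hl : ∀ A ∈ l, IsNZ A) (i : Fin n) :
    ∃ j, listProd l i j = true := by
  induction l generalizing i with
  | nil => exact ⟨i, by simp [listProd, bId]⟩
  | cons A l ih =>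
    obtain ⟨k, hk⟩ := (hl A (by simp)).1 i
    obtain ⟨j, hj⟩ := ih (fun B hB => hl B (List.mem_cons_of_mem A hB)) k
    refine ⟨j, ?_⟩
    change bProd A (listProd l) i j = true
    simpa [bProd] using ⟨k, hk, hj⟩

lemma rowSum_eq_rCount {n : ℕ} (A : BMat n) (i : Fin n) : rowSum A i = rCount A i := by
  simp [rowSum, rCount]

lemma one_le_rCount_of_mem_prodsLe {n : ℕ} {M : Set (BMat n)} (hNZ : ∀ A ∈ M, IsNZ A) {t : ℕ}
    {A : BMat n} (hA : A ∈ prodsLe M t) (i : Fin n) : 1 ≤ rCount A i := by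
  obtain ⟨l, -, hl, rfl⟩ := hA
  obtain ⟨j, hj⟩ := exists_listProd_eq_true l (fun B hB => hNZ B (hl B hB)) i
  exact Finset.card_pos.mpr ⟨j, by simpa using hj⟩

lemma payoff_le {n : ℕ} {p : Fin n → ℝ} (hp : IsStochastic p) (A : BMat n) : payoff p A ≤ n := by
  have hle : ∀ i, rowSum A i ≤ n := fun i => by
    rw [rowSum_eq_rCount]
    exact_mod_cast (Finset.card_le_univ _).trans_eq (Fintype.card_fin n)
  calc payoff p A ≤ ∑ i, p i * n :=
        Finset.sum_le_sum fun i _ => mul_le_mul_of_nonneg_left (hle i) (hp.1 i)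
    _ = n := by rw [← Finset.sum_mul, hp.2, one_mul]

lemma payoff_nonneg {n : ℕ} {p : Fin n → ℝ} (hp : IsStochastic p) (A : BMat n) :
    0 ≤ payoff p A :=
  Finset.sum_nonneg fun i _ => mul_nonneg (hp.1 i) (by rw [rowSum_eq_rCount]; positivity)

lemma maxPayoff_nonneg {n : ℕ} (M : Set (BMat n)) (t : ℕ) {p : Fin n → ℝ}
    (hp : IsStochastic p) : 0 ≤ maxPayoff M t p := by
  refine Real.sSup_nonneg ?_
  rintro x ⟨A, -, rfl⟩
  exact payoff_nonneg hp A

lemma payoff_le_maxPayoff {n : ℕ} {M : Set (BMat n)} {t : ℕ} {p : Fin n → ℝ}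
    (hp : IsStochastic p) {A : BMat n} (hA : A ∈ prodsLe M t) :
    payoff p A ≤ maxPayoff M t p := by
  refine le_csSup ⟨n, ?_⟩ ⟨A, hA, rfl⟩
  rintro x ⟨B, -, rfl⟩
  exact payoff_le hp B

lemma isStochastic_single {n : ℕ} (i : Fin n) : IsStochastic (Pi.single i (1 : ℝ)) := by
  refine ⟨fun j => ?_, by simp⟩
  exact (Pi.single_nonneg.mpr zero_le_one : (0 : Fin n → ℝ) ≤ Pi.single i 1) j

lemma payoff_single {n : ℕ} (i : Fin n) (A : BMat n) :
    payoff (Pi.single i (1 : ℝ)) A = rCount A i := by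
  simp [payoff, Pi.single_apply, rowSum_eq_rCount]

lemma bId_mem_prodsLe {n : ℕ} (M : Set (BMat n)) (t : ℕ) : bId n ∈ prodsLe M t :=
  ⟨[], by simp, by simp, rfl⟩

/-- If every row has at least one `1`, a row with two of them raises the payoff above `1`
by at least the weight of that row. -/
lemma one_add_le_payoff {n : ℕ} {p : Fin n → ℝ} (hp : IsStochastic p) {A : BMat n}
    (hA : ∀ i, 1 ≤ rCount A i) {i : Fin n} (hi : 2 ≤ rCount A i) : 1 + p i ≤ payoff p A := by
  calc 1 + p i = ∑ j, p j * (1 + if j = i then (1 : ℝ) else 0) := by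
        simp [mul_add, Finset.sum_add_distrib, hp.2]
    _ ≤ payoff p A := by
        refine Finset.sum_le_sum fun j _ => mul_le_mul_of_nonneg_left ?_ (hp.1 j)
        rw [rowSum_eq_rCount]
        split_ifs with hj
        · subst hj
          have : (2 : ℝ) ≤ rCount A j := by exact_mod_cast hi
          linarith
        · have : (1 : ℝ) ≤ rCount A j := by exact_mod_cast hA j
          linarith

lemma IsStochastic.exists_inv_le {n : ℕ} (hn : 1 ≤ n) {p : Fin n → ℝ} (hp : IsStochastic p) :
    ∃ i, (1 : ℝ) / n ≤ p i := by
  have : Nonempty (Fin n) := ⟨⟨0, hn⟩⟩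
  have hn' : (n : ℝ) ≠ 0 := by positivity
  obtain ⟨i, -, hi⟩ := Finset.exists_le_of_sum_le (s := Finset.univ)
    (f := fun _ : Fin n => (1 : ℝ) / n) (g := p) Finset.univ_nonempty (by simp [hp.2, hn'])
  exact ⟨i, hi⟩

/-- if `K_𝓜(t) > 1/n` then `K_𝓜(t) ≥ (n+1)/n²`. -/
theorem stmt_6 {n : ℕ} (hn : 1 ≤ n) (M : Set (BMat n)) (hfin : M.Finite)
    (hne : M.Nonempty) (hNZ : ∀ A ∈ M, IsNZ A) (t : ℕ)
    (h : Kval M t > 1 / n) :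
    Kval M t ≥ (n + 1) / (n : ℝ) ^ 2 := by
  have hn0 : (0 : ℝ) < n := by exact_mod_cast hn
  have hinf : 1 < sInf { v | ∃ p : Fin n → ℝ, IsStochastic p ∧ v = maxPayoff M t p } :=
    (div_lt_div_iff_of_pos_right hn0).mp h
  have hbdd : BddBelow { v | ∃ p : Fin n → ℝ, IsStochastic p ∧ v = maxPayoff M t p } := by
    refine ⟨0, ?_⟩
    rintro v ⟨p, hp, rfl⟩
    exact maxPayoff_nonneg M t hp
  have hrow : ∀ i, ∃ A ∈ prodsLe M t, 2 ≤ rCount A i := by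
    intro i
    have hi : 1 < maxPayoff M t (Pi.single i 1) :=
      hinf.trans_le (csInf_le hbdd ⟨_, isStochastic_single i, rfl⟩)
    obtain ⟨x, ⟨A, hA, rfl⟩, hx⟩ :=
      exists_lt_of_lt_csSup (by exact ⟨_, bId n, bId_mem_prodsLe M t, rfl⟩) hi
    rw [payoff_single] at hx
    exact ⟨A, hA, by exact_mod_cast hx⟩
  have hmin : 1 + 1 / (n : ℝ) ≤
      sInf { v | ∃ p : Fin n → ℝ, IsStochastic p ∧ v = maxPayoff M t p } := by
    refine le_csInf ⟨_, _, isStochastic_single ⟨0, hn⟩, rfl⟩ ?_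
    rintro v ⟨p, hp, rfl⟩
    obtain ⟨i, hi⟩ := hp.exists_inv_le hn
    obtain ⟨A, hA, hAi⟩ := hrow i
    calc 1 + 1 / (n : ℝ) ≤ 1 + p i := by linarith
      _ ≤ payoff p A := one_add_le_payoff hp (one_le_rCount_of_mem_prodsLe hNZ hA) hAi
      _ ≤ maxPayoff M t p := payoff_le_maxPayoff hp hA
  calc ((n : ℝ) + 1) / (n : ℝ) ^ 2 = (1 + 1 / (n : ℝ)) / n := by field_simp
    _ ≤ Kval M t := div_le_div_of_nonneg_right hmin hn0.le
end

section
/- Let 𝓜 be a finite nonempty set of n×n binary NZ matrices such that at least one matrix of 𝓜 dominates a permutation matrix (i.e., there exist M ∈ 𝓜 and a permutation matrix P with P ≤ M entrywise). Then for every t ≥ 1, min over stochastic vectors p ∈ ℝⁿ of max_{A ∈ 𝓜^t} pᵀ(Ae)/n = K_𝓜(t), where 𝓜^t is the set of boolean products of exactly t matrices from 𝓜. -/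
open scoped BigOperators

theorem bProd_eq_true_iff {n : ℕ} (A B : BMat n) (i j : Fin n) :
    bProd A B i j = true ↔ ∃ k, A i k = true ∧ B k j = true := by
  simp [bProd]

theorem rowSum_le_rowSum_of_perm {n : ℕ} {A B : BMat n} {i : Fin n} (τ : Equiv.Perm (Fin n))
    (h : ∀ j, A i j = true → B i (τ j) = true) : rowSum A i ≤ rowSum B i := by
  unfold rowSum
  rw [← Equiv.sum_comp τ (fun j => if B i j then (1 : ℝ) else 0)]
  refine Finset.sum_le_sum fun j _ => ?_
  by_cases hA : A i j = true
  · simp [hA, h j hA]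
  · simp only [hA, Bool.false_eq_true, if_false]
    split_ifs <;> norm_num

theorem listProd_replicate_apply {n : ℕ} {M₀ : BMat n} {σ : Equiv.Perm (Fin n)}
    (hσ : ∀ i, M₀ i (σ i) = true) (k : ℕ) (i : Fin n) :
    listProd (List.replicate k M₀) i ((σ ^ k) i) = true := by
  induction k generalizing i with
  | zero => simp [listProd, bId]
  | succ k ih =>
    rw [List.replicate_succ, pow_succ, Equiv.Perm.mul_apply]
    exact (bProd_eq_true_iff _ _ _ _).2 ⟨σ i, hσ i, ih (σ i)⟩

theorem listProd_append_replicate_apply {n : ℕ} {M₀ : BMat n} {σ : Equiv.Perm (Fin n)}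
    (hσ : ∀ i, M₀ i (σ i) = true) (k : ℕ) (l : List (BMat n)) (i j : Fin n)
    (h : listProd l i j = true) :
    listProd (l ++ List.replicate k M₀) i ((σ ^ k) j) = true := by
  induction l generalizing i with
  | nil =>
    obtain rfl : i = j := by simpa [listProd, bId] using h
    exact listProd_replicate_apply hσ k i
  | cons A l ih =>
    obtain ⟨m, hA, hm⟩ := (bProd_eq_true_iff _ _ _ _).1 h
    exact (bProd_eq_true_iff _ _ _ _).2 ⟨m, hA, ih m hm⟩

theorem payoff_mono {n : ℕ} {p : Fin n → ℝ} (hp : IsStochastic p) {A B : BMat n}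
    (h : ∀ i, rowSum A i ≤ rowSum B i) : payoff p A ≤ payoff p B :=
  Finset.sum_le_sum fun i _ => mul_le_mul_of_nonneg_left (h i) (hp.1 i)

theorem prodsEq_subset_prodsLe {n : ℕ} (M : Set (BMat n)) (t : ℕ) :
    prodsEq M t ⊆ prodsLe M t := by
  rintro P ⟨l, hl, hM, rfl⟩
  exact ⟨l, hl.le, hM, rfl⟩

theorem exists_mem_prodsEq_rowSum_le {n : ℕ} {M : Set (BMat n)} {M₀ : BMat n} (hM₀ : M₀ ∈ M)
    {σ : Equiv.Perm (Fin n)} (hσ : ∀ i, M₀ i (σ i) = true) {t : ℕ} {A : BMat n}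
    (hA : A ∈ prodsLe M t) : ∃ B ∈ prodsEq M t, ∀ i, rowSum A i ≤ rowSum B i := by
  obtain ⟨l, hl, hlM, rfl⟩ := hA
  refine ⟨_, ⟨l ++ List.replicate (t - l.length) M₀, by simp [hl], ?_, rfl⟩, fun i =>
    rowSum_le_rowSum_of_perm (σ ^ (t - l.length))
      (listProd_append_replicate_apply hσ _ l i)⟩
  intro B hB
  rcases List.mem_append.1 hB with hB | hB
  · exact hlM B hB
  · exact List.eq_of_mem_replicate hB ▸ hM₀

theorem finite_setOf_payoff {n : ℕ} (p : Fin n → ℝ) (S : Set (BMat n)) :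
    { x | ∃ A ∈ S, x = payoff p A }.Finite := by
  refine (S.toFinite.image (payoff p)).subset ?_
  rintro x ⟨A, hA, rfl⟩
  exact ⟨A, hA, rfl⟩

theorem sSup_payoff_prodsEq {n : ℕ} {M : Set (BMat n)} {M₀ : BMat n} (hM₀ : M₀ ∈ M)
    {σ : Equiv.Perm (Fin n)} (hσ : ∀ i, M₀ i (σ i) = true) (t : ℕ)
    {p : Fin n → ℝ} (hp : IsStochastic p) :
    sSup { x | ∃ A ∈ prodsEq M t, x = payoff p A } = maxPayoff M t p := by
  have hid : bId n ∈ prodsLe M t := ⟨[], by simp, by simp, rfl⟩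
  apply le_antisymm
  · obtain ⟨B, hB, -⟩ := exists_mem_prodsEq_rowSum_le hM₀ hσ hid
    refine csSup_le_csSup (finite_setOf_payoff p _).bddAbove ⟨_, B, hB, rfl⟩ ?_
    rintro x ⟨A, hA, rfl⟩
    exact ⟨A, prodsEq_subset_prodsLe M t hA, rfl⟩
  · refine csSup_le ⟨_, bId n, hid, rfl⟩ ?_
    rintro x ⟨A, hA, rfl⟩
    obtain ⟨B, hB, hAB⟩ := exists_mem_prodsEq_rowSum_le hM₀ hσ hA
    exact (payoff_mono hp hAB).trans
      (le_csSup (finite_setOf_payoff p _).bddAbove ⟨B, hB, rfl⟩)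

/-- if some matrix of `𝓜` dominates a permutation matrix, then for
every `t ≥ 1`, replacing `𝓜^{≤t}` by `𝓜^{t}` in the defining minimax does not
change the value `K_𝓜(t)`. -/
theorem stmt_9 {n : ℕ} (hn : 1 ≤ n) (M : Set (BMat n)) (hfin : M.Finite)
    (hne : M.Nonempty) (hNZ : ∀ A ∈ M, IsNZ A)
    (hdom : ∃ M0 ∈ M, ∃ σ : Equiv.Perm (Fin n), ∀ i, M0 i (σ i) = true)
    (t : ℕ) (ht : 1 ≤ t) :
    sInf { v | ∃ p : Fin n → ℝ, IsStochastic p ∧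
        v = sSup { x | ∃ A ∈ prodsEq M t, x = payoff p A } } / n = Kval M t := by
  obtain ⟨M₀, hM₀, σ, hσ⟩ := hdom
  unfold Kval
  congr 2
  ext v
  refine exists_congr fun p => and_congr_right fun hp => ?_
  rw [sSup_payoff_prodsEq hM₀ hσ t hp]
end
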